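/- arXiv:gr-qc/9906087 — 2 statements merged into one kernel-verified Lean document; each statement's English description precedes it below -/
import Mathlib

section
/- Let n = 4 and let C be a Weyl candidate on 4-dimensional Minkowski space. Then C_{αρτν} C_β{}^{ρτν} = (1/4)·η_{αβ}·C_{ρτσν} C^{ρτσν}; in particular the generalized Bel–Robinson tensor of C is completely traceless in dimension 4. -/
open Finset

noncomputable section

/-- Components of the Minkowski metric (and of its inverse) in dimension `n`. -/
def gmet (n : ℕ) (μ ν : Fin n) : ℝ :=
  if μ = ν then (if (μ : ℕ) = 0 then -1 else 1) else 0

/-- A Weyl candidate: pair antisymmetries, pair interchange symmetry,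
first Bianchi identity, and trace-free. -/
def IsWeylCandidate (n : ℕ) (C : Fin n → Fin n → Fin n → Fin n → ℝ) : Prop :=
  (∀ a b c d, C a b c d = - C b a c d) ∧
  (∀ a b c d, C a b c d = - C a b d c) ∧
  (∀ a b c d, C a b c d = C c d a b) ∧
  (∀ a b c d, C a b c d + C a c d b + C a d b c = 0) ∧
  (∀ b d, (∑ a : Fin n, ∑ c : Fin n, gmet n a c * C a b c d) = 0)

/-- The generalized Bel(-Robinson) tensor of a double symmetric `(2,2)`-form `C`:
`𝒯_{αβλμ} = C_{αρλσ} C_β{}^ρ{}_μ{}^σ + C_{αρμσ} C_β{}^ρ{}_λ{}^σ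
  − (1/2)η_{αβ} C_{ρτλσ} C^{ρτ}{}_μ{}^σ − (1/2)η_{λμ} C_{αρστ} C_β{}^{ρστ}
  + (1/8)η_{αβ}η_{λμ} C_{ρτσν} C^{ρτσν}`. -/
def belT (n : ℕ) (C : Fin n → Fin n → Fin n → Fin n → ℝ) (α β lam mu : Fin n) : ℝ :=
  (∑ ρ : Fin n, ∑ ρ' : Fin n, ∑ σ : Fin n, ∑ σ' : Fin n,
      gmet n ρ ρ' * gmet n σ σ' * C α ρ lam σ * C β ρ' mu σ')
  + (∑ ρ : Fin n, ∑ ρ' : Fin n, ∑ σ : Fin n, ∑ σ' : Fin n,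
      gmet n ρ ρ' * gmet n σ σ' * C α ρ mu σ * C β ρ' lam σ')
  - (1 / 2) * gmet n α β *
      (∑ ρ : Fin n, ∑ ρ' : Fin n, ∑ τ : Fin n, ∑ τ' : Fin n, ∑ σ : Fin n, ∑ σ' : Fin n,
        gmet n ρ ρ' * gmet n τ τ' * gmet n σ σ' * C ρ τ lam σ * C ρ' τ' mu σ')
  - (1 / 2) * gmet n lam mu *
      (∑ ρ : Fin n, ∑ ρ' : Fin n, ∑ σ : Fin n, ∑ σ' : Fin n, ∑ τ : Fin n, ∑ τ' : Fin n,
        gmet n ρ ρ' * gmet n σ σ' * gmet n τ τ' * C α ρ σ τ * C β ρ' σ' τ')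
  + (1 / 8) * gmet n α β * gmet n lam mu *
      (∑ ρ : Fin n, ∑ ρ' : Fin n, ∑ τ : Fin n, ∑ τ' : Fin n, ∑ σ : Fin n, ∑ σ' : Fin n,
       ∑ ν : Fin n, ∑ ν' : Fin n,
        gmet n ρ ρ' * gmet n τ τ' * gmet n σ σ' * gmet n ν ν' * C ρ τ σ ν * C ρ' τ' σ' ν')

set_option linter.unusedSimpArgs false

theorem gmet_coll (F : Fin 4 → Fin 4 → ℝ) :
    (∑ a : Fin 4, ∑ b : Fin 4, gmet 4 a b * F a b) = -F 0 0 + F 1 1 + F 2 2 + F 3 3 := by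
  simp [gmet, Fin.sum_univ_four]

theorem gm : gmet 4 0 0 = -1 ∧ gmet 4 0 1 = 0 ∧ gmet 4 0 2 = 0 ∧ gmet 4 0 3 = 0 ∧ gmet 4 1 0 = 0 ∧ gmet 4 1 1 = 1 ∧ gmet 4 1 2 = 0 ∧ gmet 4 1 3 = 0 ∧ gmet 4 2 0 = 0 ∧ gmet 4 2 1 = 0 ∧ gmet 4 2 2 = 1 ∧ gmet 4 2 3 = 0 ∧ gmet 4 3 0 = 0 ∧ gmet 4 3 1 = 0 ∧ gmet 4 3 2 = 0 ∧ gmet 4 3 3 = 1 := by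
  simp [gmet]

/-- The full square of `C`. -/
def sqS (C : Fin 4 → Fin 4 → Fin 4 → Fin 4 → ℝ) : ℝ :=
  (∑ ρ : Fin 4, ∑ ρ' : Fin 4, ∑ τ : Fin 4, ∑ τ' : Fin 4,
             ∑ σ : Fin 4, ∑ σ' : Fin 4, ∑ ν : Fin 4, ∑ ν' : Fin 4,
              gmet 4 ρ ρ' * gmet 4 τ τ' * gmet 4 σ σ' * gmet 4 ν ν' *
                C ρ τ σ ν * C ρ' τ' σ' ν')

theorem weyl_comps (C : Fin 4 → Fin 4 → Fin 4 → Fin 4 → ℝ) (hC : IsWeylCandidate 4 C) :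
    (∀ a c d, C a a c d = 0) ∧
    (∀ a c d, C c d a a = 0) ∧
    (∀ c d, C 1 0 c d = -C 0 1 c d) ∧
    (∀ c d, C 2 0 c d = -C 0 2 c d) ∧
    (∀ c d, C 3 0 c d = -C 0 3 c d) ∧
    (∀ c d, C 2 1 c d = -C 1 2 c d) ∧
    (∀ c d, C 3 1 c d = -C 1 3 c d) ∧
    (∀ c d, C 3 2 c d = -C 2 3 c d) ∧
    (∀ c d, C c d 1 0 = -C c d 0 1) ∧
    (∀ c d, C c d 2 0 = -C c d 0 2) ∧
    (∀ c d, C c d 3 0 = -C c d 0 3) ∧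
    (∀ c d, C c d 2 1 = -C c d 1 2) ∧
    (∀ c d, C c d 3 1 = -C c d 1 3) ∧
    (∀ c d, C c d 3 2 = -C c d 2 3) ∧
    C 0 2 0 1 = C 0 1 0 2 ∧
    C 0 3 0 1 = C 0 1 0 3 ∧
    C 1 2 0 1 = C 0 1 1 2 ∧
    C 1 3 0 1 = C 0 1 1 3 ∧
    C 2 3 0 1 = C 0 1 2 3 ∧
    C 0 3 0 2 = C 0 2 0 3 ∧
    C 1 2 0 2 = C 0 2 1 2 ∧
    C 1 3 0 2 = C 0 2 1 3 ∧
    C 2 3 0 2 = C 0 2 2 3 ∧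
    C 1 2 0 3 = C 0 3 1 2 ∧
    C 1 3 0 3 = C 0 3 1 3 ∧
    C 2 3 0 3 = C 0 3 2 3 ∧
    C 1 3 1 2 = C 1 2 1 3 ∧
    C 2 3 1 2 = C 1 2 2 3 ∧
    C 2 3 1 3 = C 1 3 2 3 ∧
    C 0 3 0 3 = -(C 0 1 0 1 + C 0 2 0 2) ∧
    C 0 3 1 3 = -C 0 2 1 2 ∧
    C 0 3 2 3 = C 0 1 1 2 ∧
    C 0 2 2 3 = -C 0 1 1 3 ∧
    C 1 3 2 3 = C 0 1 0 2 ∧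
    C 1 2 2 3 = -C 0 1 0 3 ∧
    C 1 2 1 3 = C 0 2 0 3 ∧
    C 2 3 2 3 = -C 0 1 0 1 ∧
    C 1 3 1 3 = -C 0 2 0 2 ∧
    C 1 2 1 2 = C 0 1 0 1 + C 0 2 0 2 ∧
    C 0 3 1 2 = -C 0 1 2 3 + C 0 2 1 3 := by
  obtain ⟨h1, h2, h3, h4, h5⟩ := hC
  simp only [gmet_coll] at h5
  have z1 : (∀ a c d, C a a c d = 0) := fun a c d => by linarith [h1 a a c d]
  have z2 : (∀ a c d, C c d a a = 0) := fun a c d => by linarith [h2 c d a a]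
  have p01 : (∀ c d, C 1 0 c d = -C 0 1 c d) := fun c d => h1 _ _ _ _
  have p02 : (∀ c d, C 2 0 c d = -C 0 2 c d) := fun c d => h1 _ _ _ _
  have p03 : (∀ c d, C 3 0 c d = -C 0 3 c d) := fun c d => h1 _ _ _ _
  have p12 : (∀ c d, C 2 1 c d = -C 1 2 c d) := fun c d => h1 _ _ _ _
  have p13 : (∀ c d, C 3 1 c d = -C 1 3 c d) := fun c d => h1 _ _ _ _
  have p23 : (∀ c d, C 3 2 c d = -C 2 3 c d) := fun c d => h1 _ _ _ _
  have q01 : (∀ c d, C c d 1 0 = -C c d 0 1) := fun c d => h2 _ _ _ _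
  have q02 : (∀ c d, C c d 2 0 = -C c d 0 2) := fun c d => h2 _ _ _ _
  have q03 : (∀ c d, C c d 3 0 = -C c d 0 3) := fun c d => h2 _ _ _ _
  have q12 : (∀ c d, C c d 2 1 = -C c d 1 2) := fun c d => h2 _ _ _ _
  have q13 : (∀ c d, C c d 3 1 = -C c d 1 3) := fun c d => h2 _ _ _ _
  have q23 : (∀ c d, C c d 3 2 = -C c d 2 3) := fun c d => h2 _ _ _ _
  have s0201 : C 0 2 0 1 = C 0 1 0 2 := h3 _ _ _ _
  have s0301 : C 0 3 0 1 = C 0 1 0 3 := h3 _ _ _ _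
  have s1201 : C 1 2 0 1 = C 0 1 1 2 := h3 _ _ _ _
  have s1301 : C 1 3 0 1 = C 0 1 1 3 := h3 _ _ _ _
  have s2301 : C 2 3 0 1 = C 0 1 2 3 := h3 _ _ _ _
  have s0302 : C 0 3 0 2 = C 0 2 0 3 := h3 _ _ _ _
  have s1202 : C 1 2 0 2 = C 0 2 1 2 := h3 _ _ _ _
  have s1302 : C 1 3 0 2 = C 0 2 1 3 := h3 _ _ _ _
  have s2302 : C 2 3 0 2 = C 0 2 2 3 := h3 _ _ _ _
  have s1203 : C 1 2 0 3 = C 0 3 1 2 := h3 _ _ _ _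
  have s1303 : C 1 3 0 3 = C 0 3 1 3 := h3 _ _ _ _
  have s2303 : C 2 3 0 3 = C 0 3 2 3 := h3 _ _ _ _
  have s1312 : C 1 3 1 2 = C 1 2 1 3 := h3 _ _ _ _
  have s2312 : C 2 3 1 2 = C 1 2 2 3 := h3 _ _ _ _
  have s2313 : C 2 3 1 3 = C 1 3 2 3 := h3 _ _ _ _
  have b := h4 0 1 2 3
  have t00 := h5 0 0
  have t01 := h5 0 1
  have t02 := h5 0 2
  have t03 := h5 0 3
  have t11 := h5 1 1
  have t12 := h5 1 2
  have t13 := h5 1 3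
  have t22 := h5 2 2
  have t23 := h5 2 3
  have t33 := h5 3 3
  simp only [z1, z2, p01, p02, p03, p12, p13, p23, q01, q02, q03, q12, q13, q23, s0201, s0301, s1201, s1301, s2301, s0302, s1202, s1302, s2302, s1203, s1303, s2303, s1312, s2312, s2313] at b t00 t01 t02 t03 t11 t12 t13 t22 t23 t33
  refine ⟨z1, z2, p01, p02, p03, p12, p13, p23, q01, q02, q03, q12, q13, q23, s0201, s0301, s1201, s1301, s2301, s0302, s1202, s1302, s2302, s1203, s1303, s2303, s1312, s2312, s2313, ?_, ?_, ?_, ?_, ?_, ?_, ?_, ?_, ?_, ?_, ?_⟩ <;> linarith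

theorem sqS_eq (C : Fin 4 → Fin 4 → Fin 4 → Fin 4 → ℝ) (hC : IsWeylCandidate 4 C) :
    sqS C = 16 * ((C 0 1 0 1)^2 + (C 0 1 0 2)^2 + (C 0 1 0 3)^2 + (C 0 2 0 2)^2 + (C 0 2 0 3)^2 + (C 0 1 0 1) * (C 0 2 0 2)
      - (C 0 1 1 2)^2 - (C 0 1 1 3)^2 - (C 0 2 1 2)^2 - (C 0 1 2 3)^2 - (C 0 2 1 3)^2 + (C 0 1 2 3) * (C 0 2 1 3)) := by
  have k := weyl_comps C hC
  simp only [sqS, mul_assoc, ← Finset.mul_sum, gmet_coll]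
  simp only [k, neg_mul, mul_neg, neg_neg, mul_zero, zero_mul, neg_zero, add_zero, zero_add]
  ring

theorem sq_id (C : Fin 4 → Fin 4 → Fin 4 → Fin 4 → ℝ) (hC : IsWeylCandidate 4 C) (α β : Fin 4) :
    (∑ ρ : Fin 4, ∑ ρ' : Fin 4, ∑ τ : Fin 4, ∑ τ' : Fin 4, ∑ ν : Fin 4, ∑ ν' : Fin 4,
          gmet 4 ρ ρ' * gmet 4 τ τ' * gmet 4 ν ν' * C α ρ τ ν * C β ρ' τ' ν')
        = (1 / 4) * gmet 4 α β * sqS C := by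
  rw [sqS_eq C hC]
  have k := weyl_comps C hC
  simp only [mul_assoc, ← Finset.mul_sum, gmet_coll]
  fin_cases α <;> fin_cases β <;>
    simp only [gm, Fin.zero_eta, Fin.mk_one, Fin.reduceFinMk, k, neg_mul, mul_neg, neg_neg, mul_zero, zero_mul, neg_zero, add_zero, zero_add] <;> ring

theorem sq_id2 (C : Fin 4 → Fin 4 → Fin 4 → Fin 4 → ℝ) (hC : IsWeylCandidate 4 C) (α β : Fin 4) :
    (∑ ρ : Fin 4, ∑ ρ' : Fin 4, ∑ τ : Fin 4, ∑ τ' : Fin 4, ∑ ν : Fin 4, ∑ ν' : Fin 4,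
          gmet 4 ρ ρ' * gmet 4 τ τ' * gmet 4 ν ν' * C ρ τ α ν * C ρ' τ' β ν')
        = (1 / 4) * gmet 4 α β * sqS C := by
  rw [sqS_eq C hC]
  have k := weyl_comps C hC
  simp only [mul_assoc, ← Finset.mul_sum, gmet_coll]
  fin_cases α <;> fin_cases β <;>
    simp only [gm, Fin.zero_eta, Fin.mk_one, Fin.reduceFinMk, k, neg_mul, mul_neg, neg_neg, mul_zero, zero_mul, neg_zero, add_zero, zero_add] <;> ring

theorem belT_eq (C : Fin 4 → Fin 4 → Fin 4 → Fin 4 → ℝ) (hC : IsWeylCandidate 4 C)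
    (α β lam mu : Fin 4) : belT 4 C α β lam mu =
  (∑ ρ : Fin 4, ∑ ρ' : Fin 4, ∑ σ : Fin 4, ∑ σ' : Fin 4,
      gmet 4 ρ ρ' * gmet 4 σ σ' * C α ρ lam σ * C β ρ' mu σ')
  + (∑ ρ : Fin 4, ∑ ρ' : Fin 4, ∑ σ : Fin 4, ∑ σ' : Fin 4,
      gmet 4 ρ ρ' * gmet 4 σ σ' * C α ρ mu σ * C β ρ' lam σ')
  - 1 / 8 * (gmet 4 α β * gmet 4 lam mu * sqS C) := by
  rw [belT, sq_id C hC, sq_id2 C hC]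
  change _ + _ * sqS C = _
  ring

theorem tr_ab (C : Fin 4 → Fin 4 → Fin 4 → Fin 4 → ℝ) (hC : IsWeylCandidate 4 C) (c d : Fin 4) :
    (∑ a : Fin 4, ∑ b : Fin 4, gmet 4 a b * belT 4 C a b c d) = 0 := by
  simp only [belT_eq C hC]
  rw [sqS_eq C hC]
  have k := weyl_comps C hC
  simp only [mul_assoc, ← Finset.mul_sum, gmet_coll]
  fin_cases c <;> fin_cases d <;>
    simp only [gm, Fin.zero_eta, Fin.mk_one, Fin.reduceFinMk, k, neg_mul, mul_neg, neg_neg, mul_zero, zero_mul, neg_zero, add_zero, zero_add] <;> ring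

theorem tr_ac (C : Fin 4 → Fin 4 → Fin 4 → Fin 4 → ℝ) (hC : IsWeylCandidate 4 C) (c d : Fin 4) :
    (∑ a : Fin 4, ∑ b : Fin 4, gmet 4 a b * belT 4 C a c b d) = 0 := by
  simp only [belT_eq C hC]
  rw [sqS_eq C hC]
  have k := weyl_comps C hC
  simp only [mul_assoc, ← Finset.mul_sum, gmet_coll]
  fin_cases c <;> fin_cases d <;>
    simp only [gm, Fin.zero_eta, Fin.mk_one, Fin.reduceFinMk, k, neg_mul, mul_neg, neg_neg, mul_zero, zero_mul, neg_zero, add_zero, zero_add] <;> ring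

theorem tr_cd (C : Fin 4 → Fin 4 → Fin 4 → Fin 4 → ℝ) (hC : IsWeylCandidate 4 C) (c d : Fin 4) :
    (∑ a : Fin 4, ∑ b : Fin 4, gmet 4 a b * belT 4 C c d a b) = 0 := by
  simp only [belT_eq C hC]
  rw [sqS_eq C hC]
  have k := weyl_comps C hC
  simp only [mul_assoc, ← Finset.mul_sum, gmet_coll]
  fin_cases c <;> fin_cases d <;>
    simp only [gm, Fin.zero_eta, Fin.mk_one, Fin.reduceFinMk, k, neg_mul, mul_neg, neg_neg, mul_zero, zero_mul, neg_zero, add_zero, zero_add] <;> ring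

theorem belT_sw (C : Fin 4 → Fin 4 → Fin 4 → Fin 4 → ℝ) (hC : IsWeylCandidate 4 C)
    (α β lam mu : Fin 4) : belT 4 C α β lam mu = belT 4 C α β mu lam := by
  have hg : gmet 4 lam mu = gmet 4 mu lam := by
    unfold gmet; by_cases h : lam = mu
    · subst h; rfl
    · simp [h, Ne.symm h]
  rw [belT_eq C hC, belT_eq C hC, hg]
  ring

theorem belT_sw2 (C : Fin 4 → Fin 4 → Fin 4 → Fin 4 → ℝ) (hC : IsWeylCandidate 4 C)
    (α β lam mu : Fin 4) : belT 4 C α β lam mu = belT 4 C β α lam mu := by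
  have hg : gmet 4 α β = gmet 4 β α := by
    unfold gmet; by_cases h : α = β
    · subst h; rfl
    · simp [h, Ne.symm h]
  rw [belT_eq C hC, belT_eq C hC, hg]
  simp only [mul_assoc, ← Finset.mul_sum, gmet_coll]
  ring

/-- in dimension 4, `C_{αρτν} C_β{}^{ρτν} = (1/4)η_{αβ} C_{ρτσν}C^{ρτσν}` for
every Weyl candidate `C`; in particular its generalized Bel–Robinson tensor is completely
traceless. -/
theorem weyl_square_identity_dim4
    (C : Fin 4 → Fin 4 → Fin 4 → Fin 4 → ℝ) (hC : IsWeylCandidate 4 C) :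
    (∀ α β : Fin 4,
      (∑ ρ : Fin 4, ∑ ρ' : Fin 4, ∑ τ : Fin 4, ∑ τ' : Fin 4, ∑ ν : Fin 4, ∑ ν' : Fin 4,
          gmet 4 ρ ρ' * gmet 4 τ τ' * gmet 4 ν ν' * C α ρ τ ν * C β ρ' τ' ν')
        = (1 / 4) * gmet 4 α β *
            (∑ ρ : Fin 4, ∑ ρ' : Fin 4, ∑ τ : Fin 4, ∑ τ' : Fin 4,
             ∑ σ : Fin 4, ∑ σ' : Fin 4, ∑ ν : Fin 4, ∑ ν' : Fin 4,
              gmet 4 ρ ρ' * gmet 4 τ τ' * gmet 4 σ σ' * gmet 4 ν ν' *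
                C ρ τ σ ν * C ρ' τ' σ' ν')) ∧
    (∀ c d : Fin 4, (∑ a : Fin 4, ∑ b : Fin 4, gmet 4 a b * belT 4 C a b c d) = 0) ∧
    (∀ c d : Fin 4, (∑ a : Fin 4, ∑ b : Fin 4, gmet 4 a b * belT 4 C a c b d) = 0) ∧
    (∀ c d : Fin 4, (∑ a : Fin 4, ∑ b : Fin 4, gmet 4 a b * belT 4 C a c d b) = 0) ∧
    (∀ c d : Fin 4, (∑ a : Fin 4, ∑ b : Fin 4, gmet 4 a b * belT 4 C c a b d) = 0) ∧
    (∀ c d : Fin 4, (∑ a : Fin 4, ∑ b : Fin 4, gmet 4 a b * belT 4 C c a d b) = 0) ∧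
    (∀ c d : Fin 4, (∑ a : Fin 4, ∑ b : Fin 4, gmet 4 a b * belT 4 C c d a b) = 0) := by
  refine ⟨sq_id C hC, tr_ab C hC, tr_ac C hC, fun c d => ?_, fun c d => ?_, fun c d => ?_, tr_cd C hC⟩
  · simp only [belT_sw C hC _ c d _]
    exact tr_ac C hC c d
  · simp only [belT_sw2 C hC c]
    exact tr_ac C hC c d
  · simp only [belT_sw2 C hC c, belT_sw C hC _ c d _]
    exact tr_ac C hC c d
end
end

section
/- Let φ : ℝⁿ → ℝ be a C^∞ function satisfying the flat wave equation η^{μν} ∂_μ∂_ν φ = 0 everywhere, let S_{αβλμ} be its super-energy tensor field, and let ξ₁, ξ₂, ξ₃ : ℝⁿ → ℝⁿ be C^∞ vector fields each satisfying the flat Killing equation η_{νρ} ∂_μ ξ^ρ + η_{μρ} ∂_ν ξ^ρ = 0 for all μ, ν. Define the current j_μ = S_{(μρστ)} ξ₁^ρ ξ₂^σ ξ₃^τ, where S_{(μρστ)} is the completely symmetric part of S (the average of S over all 24 permutations of its four indices). Then j is divergence-free: η^{μν} ∂_ν j_μ = 0 everywhere. -/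
open Finset

noncomputable section

/-- The partial derivative `∂_μ f` of a scalar field on flat spacetime `ℝⁿ`. -/
def pd (n : ℕ) (μ : Fin n) (f : (Fin n → ℝ) → ℝ) : (Fin n → ℝ) → ℝ :=
  fun x => fderiv ℝ f x (Pi.single μ 1)

/-- The super-energy tensor field `S_{αβλμ}` of a scalar field `φ` on flat spacetime. -/
def seS (n : ℕ) (φ : (Fin n → ℝ) → ℝ) (α β lam mu : Fin n) (x : Fin n → ℝ) : ℝ :=
  pd n α (pd n lam φ) x * pd n mu (pd n β φ) x
    + pd n α (pd n mu φ) x * pd n lam (pd n β φ) x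
    - gmet n α β *
        (∑ ρ : Fin n, ∑ σ : Fin n, gmet n ρ σ * pd n lam (pd n ρ φ) x * pd n mu (pd n σ φ) x)
    - gmet n lam mu *
        (∑ ρ : Fin n, ∑ σ : Fin n, gmet n ρ σ * pd n α (pd n ρ φ) x * pd n β (pd n σ φ) x)
    + (1 / 2) * gmet n α β * gmet n lam mu *
        (∑ ρ : Fin n, ∑ τ : Fin n, ∑ σ : Fin n, ∑ ν : Fin n,
          gmet n ρ τ * gmet n σ ν * pd n ρ (pd n σ φ) x * pd n τ (pd n ν φ) x)

/-- The completely symmetric part `S_{(μρστ)}` of the super-energy tensor field of `φ`: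
the average over all 24 permutations of the four indices. -/
def seSsym (n : ℕ) (φ : (Fin n → ℝ) → ℝ) (a b c d : Fin n) (x : Fin n → ℝ) : ℝ :=
  (1 / 24) * ∑ π : Equiv.Perm (Fin 4),
    seS n φ (![a, b, c, d] (π 0)) (![a, b, c, d] (π 1))
      (![a, b, c, d] (π 2)) (![a, b, c, d] (π 3)) x

/-- The current `j_μ = S_{(μρστ)} ξ₁^ρ ξ₂^σ ξ₃^τ`. -/
def seCurrent (n : ℕ) (φ : (Fin n → ℝ) → ℝ)
    (ξ₁ ξ₂ ξ₃ : (Fin n → ℝ) → (Fin n → ℝ)) (μ : Fin n) (x : Fin n → ℝ) : ℝ :=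
  ∑ ρ : Fin n, ∑ σ : Fin n, ∑ τ : Fin n,
    seSsym n φ μ ρ σ τ x * ξ₁ x ρ * ξ₂ x σ * ξ₃ x τ

/-- A flat Killing vector field: `η_{νρ} ∂_μ ξ^ρ + η_{μρ} ∂_ν ξ^ρ = 0`. -/
def IsFlatKilling (n : ℕ) (ξ : (Fin n → ℝ) → (Fin n → ℝ)) : Prop :=
  ∀ (x : Fin n → ℝ) (μ ν : Fin n),
    (∑ ρ : Fin n, gmet n ν ρ * pd n μ (fun y => ξ y ρ) x)
      + (∑ ρ : Fin n, gmet n μ ρ * pd n ν (fun y => ξ y ρ) x) = 0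

def esg (n : ℕ) (μ : Fin n) : ℝ := if (μ : ℕ) = 0 then -1 else 1

theorem esg_sq (n : ℕ) (μ : Fin n) : esg n μ * esg n μ = 1 := by
  unfold esg; split_ifs <;> norm_num

theorem gmet_eq (n : ℕ) (μ ν : Fin n) : gmet n μ ν = if μ = ν then esg n μ else 0 := rfl

theorem gmet_comm (n : ℕ) (μ ν : Fin n) : gmet n μ ν = gmet n ν μ := by
  rw [gmet_eq, gmet_eq]
  by_cases h : μ = ν
  · subst h; rfl
  · rw [if_neg h, if_neg (Ne.symm h)]

theorem esg_gmet_sum (n : ℕ) (b : Fin n) (X : Fin n → ℝ) :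
    ∑ a, esg n a * (gmet n a b * X a) = X b := by
  simp only [gmet_eq]
  rw [Finset.sum_eq_single b]
  · rw [if_pos rfl, ← mul_assoc, esg_sq, one_mul]
  · intro a _ h; rw [if_neg h]; ring
  · intro h; exact absurd (Finset.mem_univ b) h

theorem gmet_sum (n : ℕ) (b : Fin n) (X : Fin n → ℝ) :
    ∑ a, gmet n b a * X a = esg n b * X b := by
  simp [gmet_eq]

theorem pd_add (n : ℕ) (μ : Fin n) {f g : (Fin n → ℝ) → ℝ} (hf : Differentiable ℝ f)
    (hg : Differentiable ℝ g) (x : Fin n → ℝ) :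
    pd n μ (fun y => f y + g y) x = pd n μ f x + pd n μ g x := by
  unfold pd
  rw [fderiv_fun_add (hf x) (hg x)]; rfl

theorem pd_sub (n : ℕ) (μ : Fin n) {f g : (Fin n → ℝ) → ℝ} (hf : Differentiable ℝ f)
    (hg : Differentiable ℝ g) (x : Fin n → ℝ) :
    pd n μ (fun y => f y - g y) x = pd n μ f x - pd n μ g x := by
  unfold pd
  rw [fderiv_fun_sub (hf x) (hg x)]; rfl

theorem pd_mul (n : ℕ) (μ : Fin n) {f g : (Fin n → ℝ) → ℝ} (hf : Differentiable ℝ f)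
    (hg : Differentiable ℝ g) (x : Fin n → ℝ) :
    pd n μ (fun y => f y * g y) x = pd n μ f x * g x + f x * pd n μ g x := by
  unfold pd
  rw [fderiv_fun_mul (hf x) (hg x)]
  simp; ring

theorem pd_cmul (n : ℕ) (μ : Fin n) (c : ℝ) {g : (Fin n → ℝ) → ℝ}
    (hg : Differentiable ℝ g) (x : Fin n → ℝ) :
    pd n μ (fun y => c * g y) x = c * pd n μ g x := by
  unfold pd
  rw [fderiv_const_mul (hg x)]; rfl

theorem pd_sum (n : ℕ) (μ : Fin n) {f : Fin n → (Fin n → ℝ) → ℝ}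
    (hf : ∀ i, Differentiable ℝ (f i)) (x : Fin n → ℝ) :
    pd n μ (fun y => ∑ i, f i y) x = ∑ i, pd n μ (f i) x := by
  unfold pd
  rw [fderiv_fun_sum (fun i _ => hf i x)]
  simp

theorem pd_smooth (n : ℕ) (μ : Fin n) {f : (Fin n → ℝ) → ℝ} (hf : ContDiff ℝ (⊤ : ℕ∞) f) :
    ContDiff ℝ (⊤ : ℕ∞) (pd n μ f) := by
  unfold pd
  have h := hf.fderiv_right (m := (⊤ : ℕ∞)) (by simp)
  exact h.clm_apply contDiff_const

theorem pd_diff (n : ℕ) {f : (Fin n → ℝ) → ℝ} (hf : ContDiff ℝ (⊤ : ℕ∞) f) :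
    Differentiable ℝ f := hf.differentiable (by simp)

theorem pd_pd_comm (n : ℕ) (μ ν : Fin n) {f : (Fin n → ℝ) → ℝ} (hf : ContDiff ℝ (⊤ : ℕ∞) f)
    (x : Fin n → ℝ) : pd n μ (pd n ν f) x = pd n ν (pd n μ f) x := by
  have h2 : Differentiable ℝ (fderiv ℝ f) :=
    (hf.fderiv_right (m := (⊤ : ℕ∞)) (by simp)).differentiable (by simp)
  have key : ∀ a b : Fin n, pd n a (pd n b f) x
      = fderiv ℝ (fderiv ℝ f) x (Pi.single a 1) (Pi.single b 1) := by
    intro a b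
    unfold pd
    rw [fderiv_clm_apply (h2 x) (differentiableAt_const _)]
    simp
  have hs : IsSymmSndFDerivAt ℝ f x :=
    hf.contDiffAt.isSymmSndFDerivAt (by simp; exact WithTop.coe_le_coe.2 (le_top : (2 : ℕ∞) ≤ ⊤))
  rw [key, key]
  exact hs _ _

def KK (n : ℕ) (φ : (Fin n → ℝ) → ℝ) (a b : Fin n) (x : Fin n → ℝ) : ℝ :=
  ∑ ρ, esg n ρ * (pd n a (pd n ρ φ) x * pd n b (pd n ρ φ) x)

def NN (n : ℕ) (φ : (Fin n → ℝ) → ℝ) (x : Fin n → ℝ) : ℝ :=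
  ∑ ρ, esg n ρ * KK n φ ρ ρ x

theorem KK_comm (n : ℕ) (φ : (Fin n → ℝ) → ℝ) (a b : Fin n) (x : Fin n → ℝ) :
    KK n φ a b x = KK n φ b a x := by
  unfold KK; exact Finset.sum_congr rfl fun i _ => by ring

theorem seS_eq (n : ℕ) (φ : (Fin n → ℝ) → ℝ) (a b c d : Fin n) (x : Fin n → ℝ) :
    seS n φ a b c d x = pd n a (pd n c φ) x * pd n d (pd n b φ) x
    + pd n a (pd n d φ) x * pd n c (pd n b φ) x
    - gmet n a b * KK n φ c d x - gmet n c d * KK n φ a b x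
    + (1 / 2) * gmet n a b * gmet n c d * NN n φ x := by
  unfold seS NN KK
  simp only [mul_assoc, gmet_sum]
  congr 3
  simp only [← Finset.mul_sum, gmet_sum]

theorem perm_sum (f : Fin 4 → Fin 4 → Fin 4 → Fin 4 → ℝ) :
    ∑ π : Equiv.Perm (Fin 4), f (π 0) (π 1) (π 2) (π 3) =
      f 0 1 2 3 + f 0 1 3 2 + f 0 2 1 3 + f 0 2 3 1 + f 0 3 1 2 + f 0 3 2 1 +
      f 1 0 2 3 + f 1 0 3 2 + f 1 2 0 3 + f 1 2 3 0 + f 1 3 0 2 + f 1 3 2 0 +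
      f 2 0 1 3 + f 2 0 3 1 + f 2 1 0 3 + f 2 1 3 0 + f 2 3 0 1 + f 2 3 1 0 +
      f 3 0 1 2 + f 3 0 2 1 + f 3 1 0 2 + f 3 1 2 0 + f 3 2 0 1 + f 3 2 1 0 := by
  let g : Equiv.Perm (Fin 4) → Fin 4 × Fin 4 × Fin 4 × Fin 4 := fun π => (π 0, π 1, π 2, π 3)
  have hg : Function.Injective g := by
    intro π π' h
    simp only [g, Prod.mk.injEq] at h
    ext i; fin_cases i <;> simp [h]
  have h1 : ∑ π : Equiv.Perm (Fin 4), f (π 0) (π 1) (π 2) (π 3)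
      = ∑ p ∈ Finset.univ.image g, f p.1 p.2.1 p.2.2.1 p.2.2.2 := by
    rw [Finset.sum_image (fun a _ b _ h => hg h)]
  have h2 : Finset.univ.image g = Finset.univ.filter
      (fun p : Fin 4 × Fin 4 × Fin 4 × Fin 4 => p.1 ≠ p.2.1 ∧ p.1 ≠ p.2.2.1 ∧ p.1 ≠ p.2.2.2 ∧
        p.2.1 ≠ p.2.2.1 ∧ p.2.1 ≠ p.2.2.2 ∧ p.2.2.1 ≠ p.2.2.2) := by
    apply Finset.eq_of_subset_of_card_le
    · intro p hp
      obtain ⟨π, _, rfl⟩ := Finset.mem_image.1 hp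
      simp [g]
    · rw [Finset.card_image_of_injective _ hg, Finset.card_univ, Fintype.card_perm]
      decide +kernel
  rw [h1, h2, Finset.sum_filter]
  simp only [Fintype.sum_prod_type, Fin.sum_univ_four]
  simp
  ring

theorem seSsym_eq (n : ℕ) (φ : (Fin n → ℝ) → ℝ) (hφ : ContDiff ℝ (⊤ : ℕ∞) φ)
    (a b c d : Fin n) (x : Fin n → ℝ) :
    seSsym n φ a b c d x =
      (2 / 3) * (pd n a (pd n b φ) x * pd n c (pd n d φ) x
        + pd n a (pd n c φ) x * pd n b (pd n d φ) x
        + pd n a (pd n d φ) x * pd n b (pd n c φ) x)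
      - (1 / 3) * (gmet n a b * KK n φ c d x + gmet n a c * KK n φ b d x
        + gmet n a d * KK n φ b c x + gmet n c d * KK n φ a b x
        + gmet n b d * KK n φ a c x + gmet n b c * KK n φ a d x)
      + (1 / 6) * ((gmet n a b * gmet n c d + gmet n a c * gmet n b d
        + gmet n a d * gmet n b c) * NN n φ x) := by
  unfold seSsym
  rw [perm_sum (fun i j k l => seS n φ (![a, b, c, d] i) (![a, b, c, d] j)
      (![a, b, c, d] k) (![a, b, c, d] l) x)]
  have e0 : ![a, b, c, d] 0 = a := rfl
  have e1 : ![a, b, c, d] 1 = b := rfl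
  have e2 : ![a, b, c, d] 2 = c := rfl
  have e3 : ![a, b, c, d] 3 = d := rfl
  simp only [e0, e1, e2, e3, seS_eq]
  rw [pd_pd_comm n b a hφ, pd_pd_comm n c a hφ, pd_pd_comm n d a hφ, pd_pd_comm n c b hφ,
    pd_pd_comm n d b hφ, pd_pd_comm n d c hφ,
    KK_comm n φ b a, KK_comm n φ c a, KK_comm n φ d a, KK_comm n φ c b, KK_comm n φ d b,
    KK_comm n φ d c, gmet_comm n b a, gmet_comm n c a, gmet_comm n d a, gmet_comm n c b,
    gmet_comm n d b, gmet_comm n d c]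
  ring

/-- Third derivatives. -/
def DD (n : ℕ) (φ : (Fin n → ℝ) → ℝ) (a b c : Fin n) (x : Fin n → ℝ) : ℝ :=
  pd n a (pd n b (pd n c φ)) x

def PP (n : ℕ) (φ : (Fin n → ℝ) → ℝ) (b c d : Fin n) (x : Fin n → ℝ) : ℝ :=
  ∑ a, esg n a * (pd n b (pd n a φ) x * DD n φ c d a x)


theorem DD_comm1 (n : ℕ) (φ : (Fin n → ℝ) → ℝ) (hφ : ContDiff ℝ (⊤ : ℕ∞) φ) (x : Fin n → ℝ)
    (a b c : Fin n) : DD n φ a b c x = DD n φ b a c x :=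
  pd_pd_comm n a b (pd_smooth n c hφ) x

theorem DD_comm2 (n : ℕ) (φ : (Fin n → ℝ) → ℝ) (hφ : ContDiff ℝ (⊤ : ℕ∞) φ) (x : Fin n → ℝ)
    (a b c : Fin n) : DD n φ a b c x = DD n φ a c b x := by
  unfold DD
  congr 1
  funext y
  exact pd_pd_comm n b c hφ y

theorem PP_comm (n : ℕ) (φ : (Fin n → ℝ) → ℝ) (hφ : ContDiff ℝ (⊤ : ℕ∞) φ) (x : Fin n → ℝ)
    (b c d : Fin n) : PP n φ b c d x = PP n φ b d c x := by
  unfold PP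
  exact Finset.sum_congr rfl fun a _ => by rw [DD_comm1 n φ hφ]

theorem H_diff (n : ℕ) (φ : (Fin n → ℝ) → ℝ) (hφ : ContDiff ℝ (⊤ : ℕ∞) φ)
    (a b : Fin n) : Differentiable ℝ (pd n a (pd n b φ)) :=
  pd_diff n (pd_smooth n a (pd_smooth n b hφ))

theorem KK_diff (n : ℕ) (φ : (Fin n → ℝ) → ℝ) (hφ : ContDiff ℝ (⊤ : ℕ∞) φ)
    (a b : Fin n) : Differentiable ℝ (KK n φ a b) := by
  unfold KK
  have := H_diff n φ hφ
  fun_prop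

theorem NN_diff (n : ℕ) (φ : (Fin n → ℝ) → ℝ) (hφ : ContDiff ℝ (⊤ : ℕ∞) φ)
    : Differentiable ℝ (NN n φ) := by
  unfold NN
  have := KK_diff n φ hφ
  fun_prop

theorem KK_pd (n : ℕ) (φ : (Fin n → ℝ) → ℝ) (hφ : ContDiff ℝ (⊤ : ℕ∞) φ) (x : Fin n → ℝ)
    (f a b : Fin n) : pd n f (KK n φ a b) x = PP n φ b f a x + PP n φ a f b x := by
  have h := H_diff n φ hφ
  unfold KK PP
  rw [pd_sum n f (fun i => by fun_prop), ← Finset.sum_add_distrib]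
  refine Finset.sum_congr rfl fun i _ => ?_
  rw [pd_cmul n f _ (by fun_prop), pd_mul n f (h _ _) (h _ _)]
  unfold DD
  ring

theorem NN_pd (n : ℕ) (φ : (Fin n → ℝ) → ℝ) (hφ : ContDiff ℝ (⊤ : ℕ∞) φ) (x : Fin n → ℝ)
    (f : Fin n) : pd n f (NN n φ) x = 2 * ∑ a, esg n a * PP n φ a f a x := by
  have h := KK_diff n φ hφ
  unfold NN
  rw [pd_sum n f (fun i => by fun_prop), Finset.mul_sum]
  refine Finset.sum_congr rfl fun i _ => ?_
  rw [pd_cmul n f _ (by fun_prop), KK_pd n φ hφ]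
  ring

theorem seSsym_diff (n : ℕ) (φ : (Fin n → ℝ) → ℝ) (hφ : ContDiff ℝ (⊤ : ℕ∞) φ)
    (a b c d : Fin n) : Differentiable ℝ (seSsym n φ a b c d) := by
  have h := H_diff n φ hφ
  have hK := KK_diff n φ hφ
  have hN := NN_diff n φ hφ
  rw [funext (seSsym_eq n φ hφ a b c d)]
  fun_prop

theorem seSsym_pd (n : ℕ) (φ : (Fin n → ℝ) → ℝ) (hφ : ContDiff ℝ (⊤ : ℕ∞) φ) (x : Fin n → ℝ)
    (f a b c d : Fin n) :
    pd n f (seSsym n φ a b c d) x =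
      (2 / 3) * ((DD n φ f a b x * pd n c (pd n d φ) x + pd n a (pd n b φ) x * DD n φ f c d x)
        + (DD n φ f a c x * pd n b (pd n d φ) x + pd n a (pd n c φ) x * DD n φ f b d x)
        + (DD n φ f a d x * pd n b (pd n c φ) x + pd n a (pd n d φ) x * DD n φ f b c x))
      - (1 / 3) * (gmet n a b * pd n f (KK n φ c d) x + gmet n a c * pd n f (KK n φ b d) x
        + gmet n a d * pd n f (KK n φ b c) x + gmet n c d * pd n f (KK n φ a b) x
        + gmet n b d * pd n f (KK n φ a c) x + gmet n b c * pd n f (KK n φ a d) x)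
      + (1 / 6) * ((gmet n a b * gmet n c d + gmet n a c * gmet n b d
        + gmet n a d * gmet n b c) * pd n f (NN n φ) x) := by
  have h := H_diff n φ hφ
  have hK := KK_diff n φ hφ
  have hN := NN_diff n φ hφ
  rw [funext (seSsym_eq n φ hφ a b c d)]
  rw [pd_add n f (by fun_prop) (by fun_prop), pd_sub n f (by fun_prop) (by fun_prop),
    pd_cmul n f _ (by fun_prop), pd_cmul n f _ (by fun_prop), pd_cmul n f _ (by fun_prop),
    pd_cmul n f _ (by fun_prop),
    pd_add n f (by fun_prop) (by fun_prop), pd_add n f (by fun_prop) (by fun_prop),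
    pd_add n f (by fun_prop) (by fun_prop), pd_add n f (by fun_prop) (by fun_prop),
    pd_add n f (by fun_prop) (by fun_prop), pd_add n f (by fun_prop) (by fun_prop),
    pd_add n f (by fun_prop) (by fun_prop),
    pd_mul n f (h _ _) (h _ _), pd_mul n f (h _ _) (h _ _), pd_mul n f (h _ _) (h _ _),
    pd_cmul n f _ (hK _ _), pd_cmul n f _ (hK _ _), pd_cmul n f _ (hK _ _),
    pd_cmul n f _ (hK _ _), pd_cmul n f _ (hK _ _), pd_cmul n f _ (hK _ _)]
  rfl

theorem wave_DD (n : ℕ) (φ : (Fin n → ℝ) → ℝ) (hφ : ContDiff ℝ (⊤ : ℕ∞) φ) (x : Fin n → ℝ)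
    (hwave : ∀ x : Fin n → ℝ,
      (∑ μ : Fin n, ∑ ν : Fin n, gmet n μ ν * pd n μ (pd n ν φ) x) = 0) (b : Fin n) :
    ∑ a, esg n a * DD n φ a a b x = 0 := by
  have h := H_diff n φ hφ
  have h1 : (fun y => ∑ a, esg n a * pd n a (pd n a φ) y) = fun _ => (0 : ℝ) := by
    funext y
    rw [← hwave y]
    simp only [gmet_sum]
  have h2 : pd n b (fun y => ∑ a, esg n a * pd n a (pd n a φ) y) x = 0 := by
    rw [h1]; simp [pd]
  rw [pd_sum n b (fun i => by fun_prop)] at h2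
  rw [← h2]
  refine Finset.sum_congr rfl fun i _ => ?_
  rw [pd_cmul n b _ (h _ _), DD_comm2 n φ hφ, DD_comm1 n φ hφ]
  rfl

theorem seSsym_div (n : ℕ) (φ : (Fin n → ℝ) → ℝ) (hφ : ContDiff ℝ (⊤ : ℕ∞) φ) (x : Fin n → ℝ)
    (hwave : ∀ x : Fin n → ℝ,
      (∑ μ : Fin n, ∑ ν : Fin n, gmet n μ ν * pd n μ (pd n ν φ) x) = 0) (b c d : Fin n) :
    ∑ a, esg n a * pd n a (seSsym n φ a b c d) x = 0 := by
  have hW := wave_DD n φ hφ x hwave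
  have hP : ∀ b c d : Fin n, ∑ a, esg n a * (pd n a (pd n b φ) x * DD n φ a c d x)
      = PP n φ b c d x := by
    intro b c d
    unfold PP
    refine Finset.sum_congr rfl fun a _ => ?_
    rw [pd_pd_comm n a b hφ, DD_comm1 n φ hφ x a c d, DD_comm2 n φ hφ x c a d]
  have hK1 : ∀ b : Fin n, ∑ a, esg n a * pd n a (KK n φ a b) x = (1 / 2) * pd n b (NN n φ) x := by
    intro b
    have h0 : ∑ a, esg n a * PP n φ b a a x = 0 := by
      unfold PP
      simp only [Finset.mul_sum]
      rw [Finset.sum_comm]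
      refine Finset.sum_eq_zero fun e _ => ?_
      have : ∀ a, esg n a * (esg n e * (pd n b (pd n e φ) x * DD n φ a a e x))
          = (esg n e * pd n b (pd n e φ) x) * (esg n a * DD n φ a a e x) := fun a => by ring
      simp only [this]
      rw [← Finset.mul_sum, hW, mul_zero]
    rw [NN_pd n φ hφ]
    simp only [KK_pd n φ hφ, mul_add, Finset.sum_add_distrib, h0]
    simp only [fun a => PP_comm n φ hφ x a b a]
    ring
  have expand : ∀ a, esg n a * pd n a (seSsym n φ a b c d) x =
      (2 / 3) * (esg n a * DD n φ a a b x * pd n c (pd n d φ) x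
        + esg n a * DD n φ a a c x * pd n b (pd n d φ) x
        + esg n a * DD n φ a a d x * pd n b (pd n c φ) x
        + esg n a * (pd n a (pd n b φ) x * DD n φ a c d x)
        + esg n a * (pd n a (pd n c φ) x * DD n φ a b d x)
        + esg n a * (pd n a (pd n d φ) x * DD n φ a b c x))
      - (1 / 3) * (esg n a * (gmet n a b * pd n a (KK n φ c d) x)
        + esg n a * (gmet n a c * pd n a (KK n φ b d) x)
        + esg n a * (gmet n a d * pd n a (KK n φ b c) x)
        + gmet n c d * (esg n a * pd n a (KK n φ a b) x)
        + gmet n b d * (esg n a * pd n a (KK n φ a c) x)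
        + gmet n b c * (esg n a * pd n a (KK n φ a d) x))
      + (1 / 6) * (gmet n c d * (esg n a * (gmet n a b * pd n a (NN n φ) x))
        + gmet n b d * (esg n a * (gmet n a c * pd n a (NN n φ) x))
        + gmet n b c * (esg n a * (gmet n a d * pd n a (NN n φ) x))) := by
    intro a
    rw [seSsym_pd n φ hφ]
    ring
  simp only [expand, Finset.sum_add_distrib, Finset.sum_sub_distrib, ← Finset.mul_sum,
    ← Finset.sum_mul, hW, hP, hK1]
  rw [esg_gmet_sum n b (fun a => pd n a (KK n φ c d) x),
    esg_gmet_sum n c (fun a => pd n a (KK n φ b d) x),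
    esg_gmet_sum n d (fun a => pd n a (KK n φ b c) x),
    esg_gmet_sum n b (fun a => pd n a (NN n φ) x),
    esg_gmet_sum n c (fun a => pd n a (NN n φ) x),
    esg_gmet_sum n d (fun a => pd n a (NN n φ) x)]
  simp only [KK_pd n φ hφ]
  rw [PP_comm n φ hφ x d c b, PP_comm n φ hφ x c d b, PP_comm n φ hφ x b d c]
  ring

theorem seSsym_swap (n : ℕ) (φ : (Fin n → ℝ) → ℝ) (hφ : ContDiff ℝ (⊤ : ℕ∞) φ)
    (x : Fin n → ℝ) (a b c d : Fin n) :
    seSsym n φ a b c d x = seSsym n φ b a c d x := by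
  rw [seSsym_eq n φ hφ, seSsym_eq n φ hφ, pd_pd_comm n b a hφ, gmet_comm n b a, KK_comm n φ b a]
  ring

theorem seSsym_swap' (n : ℕ) (φ : (Fin n → ℝ) → ℝ) (hφ : ContDiff ℝ (⊤ : ℕ∞) φ)
    (x : Fin n → ℝ) (a b c d : Fin n) :
    seSsym n φ a b c d x = seSsym n φ c b a d x := by
  rw [seSsym_eq n φ hφ, seSsym_eq n φ hφ, pd_pd_comm n c a hφ, pd_pd_comm n c b hφ,
    gmet_comm n c a, gmet_comm n c b, gmet_comm n b a, KK_comm n φ c a, KK_comm n φ c b,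
    KK_comm n φ b a, pd_pd_comm n b a hφ]
  ring

theorem seSsym_swap'' (n : ℕ) (φ : (Fin n → ℝ) → ℝ) (hφ : ContDiff ℝ (⊤ : ℕ∞) φ)
    (x : Fin n → ℝ) (a b c d : Fin n) :
    seSsym n φ a b c d x = seSsym n φ d b c a x := by
  rw [seSsym_eq n φ hφ, seSsym_eq n φ hφ, pd_pd_comm n d a hφ, pd_pd_comm n d b hφ,
    pd_pd_comm n d c hφ, pd_pd_comm n c a hφ, pd_pd_comm n b a hφ,
    gmet_comm n d a, gmet_comm n d b, gmet_comm n d c, gmet_comm n b a, gmet_comm n c a,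
    KK_comm n φ d a, KK_comm n φ d b, KK_comm n φ d c, KK_comm n φ c a, KK_comm n φ b a]
  ring

theorem killing_contract (n : ℕ) (ξ : (Fin n → ℝ) → (Fin n → ℝ)) (hξ : IsFlatKilling n ξ)
    (x : Fin n → ℝ) (M : Fin n → Fin n → ℝ) (hM : ∀ a b, M a b = M b a) :
    ∑ a, ∑ b, esg n a * pd n a (fun y => ξ y b) x * M a b = 0 := by
  have hA : ∀ a b, esg n a * pd n a (fun y => ξ y b) x
      = - (esg n b * pd n b (fun y => ξ y a) x) := by
    intro a b
    have h := hξ x a b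
    rw [gmet_sum, gmet_sum] at h
    have ha := esg_sq n a
    have hb := esg_sq n b
    linear_combination esg n a * esg n b * h - esg n a * pd n a (fun y => ξ y b) x * hb
      - esg n b * pd n b (fun y => ξ y a) x * ha
  have h1 : ∑ a, ∑ b, esg n a * pd n a (fun y => ξ y b) x * M a b
      = - ∑ a, ∑ b, esg n a * pd n a (fun y => ξ y b) x * M a b := by
    conv_lhs => rw [Finset.sum_comm]
    rw [← Finset.sum_neg_distrib]
    refine Finset.sum_congr rfl fun a _ => ?_
    rw [← Finset.sum_neg_distrib]
    refine Finset.sum_congr rfl fun b _ => ?_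
    rw [hA b a, hM b a]; ring
  linarith

/-- for a smooth solution of the flat wave equation and three flat Killing
vector fields, the current `j_μ = S_{(μρστ)} ξ₁^ρ ξ₂^σ ξ₃^τ` is divergence-free. -/
theorem seCurrent_divergence_free
    (n : ℕ) (φ : (Fin n → ℝ) → ℝ) (hφ : ContDiff ℝ (⊤ : ℕ∞) φ)
    (hwave : ∀ x : Fin n → ℝ,
      (∑ μ : Fin n, ∑ ν : Fin n, gmet n μ ν * pd n μ (pd n ν φ) x) = 0)
    (ξ₁ ξ₂ ξ₃ : (Fin n → ℝ) → (Fin n → ℝ))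
    (hξ₁s : ContDiff ℝ (⊤ : ℕ∞) ξ₁) (hξ₂s : ContDiff ℝ (⊤ : ℕ∞) ξ₂)
    (hξ₃s : ContDiff ℝ (⊤ : ℕ∞) ξ₃)
    (hξ₁ : IsFlatKilling n ξ₁) (hξ₂ : IsFlatKilling n ξ₂) (hξ₃ : IsFlatKilling n ξ₃) :
    ∀ x : Fin n → ℝ,
      (∑ μ : Fin n, ∑ ν : Fin n,
        gmet n μ ν * pd n ν (seCurrent n φ ξ₁ ξ₂ ξ₃ μ) x) = 0 := by
  intro x
  have hS := seSsym_diff n φ hφ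
  have d1 : ∀ i, Differentiable ℝ (fun y => ξ₁ y i) := fun i =>
    differentiable_pi.1 (hξ₁s.differentiable (by simp)) i
  have d2 : ∀ i, Differentiable ℝ (fun y => ξ₂ y i) := fun i =>
    differentiable_pi.1 (hξ₂s.differentiable (by simp)) i
  have d3 : ∀ i, Differentiable ℝ (fun y => ξ₃ y i) := fun i =>
    differentiable_pi.1 (hξ₃s.differentiable (by simp)) i
  have t1 : ∀ a b c d, Differentiable ℝ (fun y => seSsym n φ a b c d y * ξ₁ y b) :=
    fun a b c d => (hS a b c d).mul (d1 b)
  have t2 : ∀ a b c d, Differentiable ℝ (fun y => seSsym n φ a b c d y * ξ₁ y b * ξ₂ y c) :=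
    fun a b c d => (t1 a b c d).mul (d2 c)
  have t3 : ∀ a b c d, Differentiable ℝ
      (fun y => seSsym n φ a b c d y * ξ₁ y b * ξ₂ y c * ξ₃ y d) :=
    fun a b c d => (t2 a b c d).mul (d3 d)
  have hj : ∀ a, pd n a (seCurrent n φ ξ₁ ξ₂ ξ₃ a) x = ∑ b, ∑ c, ∑ d,
      (pd n a (seSsym n φ a b c d) x * (ξ₁ x b * ξ₂ x c * ξ₃ x d)
      + pd n a (fun y => ξ₁ y b) x * seSsym n φ a b c d x * (ξ₂ x c * ξ₃ x d)
      + pd n a (fun y => ξ₂ y c) x * seSsym n φ a b c d x * (ξ₁ x b * ξ₃ x d)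
      + pd n a (fun y => ξ₃ y d) x * seSsym n φ a b c d x * (ξ₁ x b * ξ₂ x c)) := by
    intro a
    unfold seCurrent
    rw [pd_sum n a (fun b => Differentiable.fun_sum fun c _ =>
      Differentiable.fun_sum fun d _ => t3 a b c d)]
    refine Finset.sum_congr rfl fun b _ => ?_
    rw [pd_sum n a (fun c => Differentiable.fun_sum fun d _ => t3 a b c d)]
    refine Finset.sum_congr rfl fun c _ => ?_
    rw [pd_sum n a (fun d => t3 a b c d)]
    refine Finset.sum_congr rfl fun d _ => ?_
    rw [pd_mul n a (t2 a b c d) (d3 d), pd_mul n a (t1 a b c d) (d2 c),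
      pd_mul n a (hS a b c d) (d1 b)]
    ring
  have hexp : ∀ a, esg n a * pd n a (seCurrent n φ ξ₁ ξ₂ ξ₃ a) x =
      (∑ b, ∑ c, ∑ d, (ξ₁ x b * ξ₂ x c * ξ₃ x d) * (esg n a * pd n a (seSsym n φ a b c d) x))
      + (∑ c, ∑ d, ∑ b, (ξ₂ x c * ξ₃ x d) *
          (esg n a * pd n a (fun y => ξ₁ y b) x * seSsym n φ a b c d x))
      + (∑ b, ∑ d, ∑ c, (ξ₁ x b * ξ₃ x d) *
          (esg n a * pd n a (fun y => ξ₂ y c) x * seSsym n φ a b c d x))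
      + (∑ b, ∑ c, ∑ d, (ξ₁ x b * ξ₂ x c) *
          (esg n a * pd n a (fun y => ξ₃ y d) x * seSsym n φ a b c d x)) := by
    intro a
    have e1 : (∑ c, ∑ d, ∑ b, (ξ₂ x c * ξ₃ x d) *
          (esg n a * pd n a (fun y => ξ₁ y b) x * seSsym n φ a b c d x))
        = ∑ b, ∑ c, ∑ d, (ξ₂ x c * ξ₃ x d) *
          (esg n a * pd n a (fun y => ξ₁ y b) x * seSsym n φ a b c d x) := by
      simp only [fun c : Fin n => Finset.sum_comm (s := (Finset.univ : Finset (Fin n)))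
        (t := (Finset.univ : Finset (Fin n)))
        (f := fun d b => (ξ₂ x c * ξ₃ x d) *
          (esg n a * pd n a (fun y => ξ₁ y b) x * seSsym n φ a b c d x))]
      rw [Finset.sum_comm]
    have e2 : (∑ b, ∑ d, ∑ c, (ξ₁ x b * ξ₃ x d) *
          (esg n a * pd n a (fun y => ξ₂ y c) x * seSsym n φ a b c d x))
        = ∑ b, ∑ c, ∑ d, (ξ₁ x b * ξ₃ x d) *
          (esg n a * pd n a (fun y => ξ₂ y c) x * seSsym n φ a b c d x) :=
      Finset.sum_congr rfl fun b _ => Finset.sum_comm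
    rw [e1, e2, hj]
    simp only [← Finset.sum_add_distrib, Finset.mul_sum]
    refine Finset.sum_congr rfl fun b _ => Finset.sum_congr rfl fun c _ =>
      Finset.sum_congr rfl fun d _ => ?_
    ring
  have pull : ∀ F : Fin n → Fin n → Fin n → Fin n → ℝ,
      (∀ b c, ∑ a, ∑ d, F a b c d = 0) → ∑ a, ∑ b, ∑ c, ∑ d, F a b c d = 0 := by
    intro F hF
    rw [Finset.sum_comm]
    refine Finset.sum_eq_zero fun b _ => ?_
    rw [Finset.sum_comm]
    exact Finset.sum_eq_zero fun c _ => hF b c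
  simp only [gmet_sum]
  simp only [hexp, Finset.sum_add_distrib]
  rw [pull, pull, pull, pull]
  · ring
  · intro b c
    simp only [← Finset.mul_sum]
    rw [killing_contract n ξ₃ hξ₃ x (fun a d => seSsym n φ a b c d x)
      (fun a d => seSsym_swap'' n φ hφ x a b c d), mul_zero]
  · intro b d
    simp only [← Finset.mul_sum]
    rw [killing_contract n ξ₂ hξ₂ x (fun a c => seSsym n φ a b c d x)
      (fun a c => seSsym_swap' n φ hφ x a b c d), mul_zero]
  · intro c d
    simp only [← Finset.mul_sum]
    rw [killing_contract n ξ₁ hξ₁ x (fun a b => seSsym n φ a b c d x)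
      (fun a b => seSsym_swap n φ hφ x a b c d), mul_zero]
  · intro b c
    rw [Finset.sum_comm]
    refine Finset.sum_eq_zero fun d _ => ?_
    rw [← Finset.mul_sum, seSsym_div n φ hφ x hwave, mul_zero]
end
end
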